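/- Let F be a suitable relation on a compact metric space X. Let D⁺_F = ⋂_{n∈ℕ} ((f_F)ⁿ)⁻¹(X) be the set of points x such that the forward orbit (f_F)ⁿ(x) is defined and lies in ONE_F for all n, and let t_F : D⁺_F → D⁺_F be the restriction of f_F. Let X⁺_F = {z ∈ X^ℕ : (z_n, z_{n+1}) ∈ F for all n ∈ ℕ} with the product topology, and define the orbit map o⁺_F : D⁺_F → X⁺_F by o⁺_F(x)_n = (t_F)ⁿ(x). Then: (a) D⁺_F is a dense Gδ subset of X; (b) o⁺_F is a homeomorphism from D⁺_F onto X⁺_F ∩ π₀⁻¹(D⁺_F); (c) the closed set S⁺_F = closure(o⁺_F(D⁺_F)) is the unique closed subset of X⁺_F which is minimal for the restriction to X⁺_F of the coordinate projection π₀, and the restriction ρ₀ : S⁺_F → X of π₀ is irreducible; (d) S⁺_F is positively invariant under the shift map σ (defined by σ(z)_n = z_{n+1}), and the restriction s_F of σ to S⁺_F is an almost open continuous map. -/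

import Mathlib

open Set Topology

/-- A continuous map is *almost open* if the image of every nonempty open set
has nonempty interior. -/
def AlmostOpen {α β : Type*} [TopologicalSpace α] [TopologicalSpace β] (f : α → β) : Prop :=
  ∀ U : Set α, IsOpen U → U.Nonempty → (interior (f '' U)).Nonempty

/-- A surjective continuous map is *irreducible* when the only closed subset of its
domain mapping onto the codomain is the whole domain. -/
def IrreducibleMap {α β : Type*} [TopologicalSpace α] [TopologicalSpace β] (f : α → β) : Prop :=
  Function.Surjective f ∧ ∀ A : Set α, IsClosed A → f '' A = Set.univ → A = Set.univ

/-- The restriction to a relation `F ⊆ X₁ × X₂` of the first-coordinate projection. -/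
def projOne {X₁ X₂ : Type*} (F : Set (X₁ × X₂)) : F → X₁ := fun p => (p : X₁ × X₂).1

/-- The restriction to a relation `F ⊆ X₁ × X₂` of the second-coordinate projection. -/
def projTwo {X₁ X₂ : Type*} (F : Set (X₁ × X₂)) : F → X₂ := fun p => (p : X₁ × X₂).2

/-- A *suitable relation* is a closed relation with irreducible first projection and
almost open second projection. -/
def Suitable {X₁ X₂ : Type*} [TopologicalSpace X₁] [TopologicalSpace X₂]
    (F : Set (X₁ × X₂)) : Prop :=
  IsClosed F ∧ IrreducibleMap (projOne F) ∧ AlmostOpen (projTwo F)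

/-- `ONE F` is the set of points `x` such that `F(x)` is a singleton. -/
def ONE {X₁ X₂ : Type*} (F : Set (X₁ × X₂)) : Set X₁ := {x | ∃ y, {y' | (x, y') ∈ F} = {y}}

theorem aux_open {X : Type*} [MetricSpace X] [CompactSpace X]
    (F : Set (X × X)) (hF : Suitable F) (W : Set (X × X)) (hW : IsOpen W) :
    IsOpen {x | ∀ y, (x, y) ∈ F → (x, y) ∈ W} := by
  have h : {x | ∀ y, (x, y) ∈ F → (x, y) ∈ W} = (Prod.fst '' (F \ W))ᶜ := by
    ext x
    simp only [mem_ofPred_eq, mem_compl_iff, mem_image, mem_sdiff, Prod.exists, not_exists]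
    constructor
    · rintro h a b ⟨⟨h1, h2⟩, rfl⟩
      exact h2 (h _ h1)
    · intro h y hy
      by_contra hc
      exact h x y ⟨⟨hy, hc⟩, rfl⟩
  rw [h]
  exact (((hF.1.sdiff hW).isCompact).image continuous_fst).isClosed.isOpen_compl

theorem aux_nonempty {X : Type*} [MetricSpace X] [CompactSpace X]
    (F : Set (X × X)) (hF : Suitable F) (W : Set (X × X)) (hW : IsOpen W)
    (hne : (F ∩ W).Nonempty) :
    ∃ x, ∀ y, (x, y) ∈ F → (x, y) ∈ W := by
  by_contra hc
  push Not at hc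
  obtain ⟨p, hp, hpW⟩ := hne
  have := hF.2.1.2 (Subtype.val ⁻¹' Wᶜ) (hW.isClosed_compl.preimage continuous_subtype_val) (by
    ext x
    obtain ⟨y, hy, hyW⟩ := hc x
    simp only [mem_image, mem_univ, iff_true]
    exact ⟨⟨(x, y), hy⟩, hyW, rfl⟩)
  have h2 : (⟨p, hp⟩ : F) ∈ (Subtype.val ⁻¹' Wᶜ : Set F) := this ▸ mem_univ _
  exact h2 hpW

theorem aux_tot {X : Type*} [MetricSpace X] [CompactSpace X]
    (F : Set (X × X)) (hF : Suitable F) (x : X) : ∃ y, (x, y) ∈ F := by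
  obtain ⟨⟨p, hp⟩, h⟩ := hF.2.1.1 x
  exact ⟨p.2, by cases h; exact hp⟩

theorem aux_meet {X : Type*} [MetricSpace X] [CompactSpace X]
    (F : Set (X × X)) (hF : Suitable F) (V : Set X) (hV : IsOpen V) (hne : V.Nonempty) :
    (interior (Prod.snd '' (F ∩ Prod.fst ⁻¹' V))).Nonempty := by
  obtain ⟨x, hx⟩ := hne
  obtain ⟨y, hy⟩ := aux_tot F hF x
  have := hF.2.2 (Subtype.val ⁻¹' (Prod.fst ⁻¹' V))
    ((hV.preimage continuous_fst).preimage continuous_subtype_val) ⟨⟨(x, y), hy⟩, hx⟩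
  refine this.mono (interior_mono ?_)
  rintro _ ⟨⟨p, hp⟩, h, rfl⟩
  exact ⟨p, ⟨hp, h⟩, rfl⟩

theorem aux_pull_dense {X : Type*} [MetricSpace X] [CompactSpace X]
    (F : Set (X × X)) (hF : Suitable F) (G : Set X) (hG : IsOpen G) (hd : Dense G) :
    Dense {x | ∀ y, (x, y) ∈ F → y ∈ G} := by
  rw [dense_iff_inter_open]
  intro V hV hne
  have h1 := aux_meet F hF V hV hne
  obtain ⟨y, hy, hyG⟩ := (dense_iff_inter_open.1 hd) _ isOpen_interior h1
  obtain ⟨p, ⟨hp, hpV⟩, rfl⟩ := interior_subset hy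
  obtain ⟨x, hx⟩ := aux_nonempty F hF (V ×ˢ G) (hV.prod hG) ⟨p, hp, hpV, hyG⟩
  obtain ⟨y, hy⟩ := aux_tot F hF x
  exact ⟨x, (hx y hy).1, fun y hy => (hx y hy).2⟩

theorem aux_pull_open {X : Type*} [MetricSpace X] [CompactSpace X]
    (F : Set (X × X)) (hF : Suitable F) (G : Set X) (hG : IsOpen G) :
    IsOpen {x | ∀ y, (x, y) ∈ F → y ∈ G} :=
  aux_open F hF (Prod.snd ⁻¹' G) (hG.preimage continuous_snd)

theorem aux_one {X : Type*} [MetricSpace X] [CompactSpace X]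
    (F : Set (X × X)) (hF : Suitable F) : IsGδ (ONE F) ∧ Dense (ONE F) := by
  let g : ℕ → Set X := fun n =>
    {x | ∀ y y', (x, y) ∈ F → (x, y') ∈ F → dist y y' < 1 / ((n : ℝ) + 1)}
  have hE : ONE F = ⋂ n, g n := by
    ext x
    simp only [mem_iInter]
    constructor
    · rintro ⟨y, hy⟩ n a b ha hb
      have h1 : a ∈ {y' | (x, y') ∈ F} := ha
      have h2 : b ∈ {y' | (x, y') ∈ F} := hb
      rw [hy] at h1 h2
      rw [mem_singleton_iff] at h1 h2
      subst h1; subst h2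
      rw [dist_self]
      positivity
    · intro h
      obtain ⟨y, hy⟩ := aux_tot F hF x
      refine ⟨y, ?_⟩
      ext y'
      simp only [mem_ofPred_eq, mem_singleton_iff]
      constructor
      · intro hy'
        by_contra hne
        obtain ⟨n, hn⟩ := exists_nat_one_div_lt (dist_pos.2 hne)
        exact absurd (h n y' y hy' hy) (not_lt.2 hn.le)
      · rintro rfl; exact hy
  have ho : ∀ n, IsOpen (g n) := by
    intro n
    have h : g n = ((fun t : X × X × X => t.1) '' {t : X × X × X | ((t.1, t.2.1) ∈ F ∧
        (t.1, t.2.2) ∈ F) ∧ 1 / ((n : ℝ) + 1) ≤ dist t.2.1 t.2.2})ᶜ := by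
      ext x
      simp only [mem_compl_iff, mem_image, not_exists]
      constructor
      · rintro h ⟨a, b, c⟩ ⟨⟨⟨h1, h2⟩, h3⟩, rfl⟩
        exact absurd (h _ _ h1 h2) (not_lt.2 h3)
      · intro h y y' hy hy'
        by_contra hc
        exact h (x, y, y') ⟨⟨⟨hy, hy'⟩, not_lt.1 hc⟩, rfl⟩
    rw [h]
    refine (IsCompact.image (IsClosed.isCompact ?_) continuous_fst).isClosed.isOpen_compl
    have c1 : IsClosed {t : X × X × X | (t.1, t.2.1) ∈ F} :=
      hF.1.preimage (by fun_prop : Continuous fun t : X × X × X => (t.1, t.2.1))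
    have c2 : IsClosed {t : X × X × X | (t.1, t.2.2) ∈ F} :=
      hF.1.preimage (by fun_prop : Continuous fun t : X × X × X => (t.1, t.2.2))
    have c3 : IsClosed {t : X × X × X | 1 / ((n : ℝ) + 1) ≤ dist t.2.1 t.2.2} :=
      isClosed_le continuous_const (by fun_prop)
    exact (c1.inter c2).inter c3
  have hd : ∀ n, Dense (g n) := by
    intro n
    rw [dense_iff_inter_open]
    intro V hV ⟨x, hx⟩
    obtain ⟨y, hy⟩ := aux_tot F hF x
    have hpos : (0 : ℝ) < 1 / ((n : ℝ) + 1) := by positivity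
    obtain ⟨a, ha⟩ := aux_nonempty F hF (V ×ˢ Metric.ball y (1 / ((n : ℝ) + 1) / 2))
      (hV.prod Metric.isOpen_ball)
      ⟨(x, y), hy, hx, Metric.mem_ball_self (by positivity)⟩
    obtain ⟨b, hb⟩ := aux_tot F hF a
    refine ⟨a, (ha b hb).1, fun c d hc hd => ?_⟩
    have h1 : dist c y < _ := (ha c hc).2
    have h2 : dist d y < _ := (ha d hd).2
    have := dist_triangle_right c d y
    linarith
  rw [hE]
  exact ⟨IsGδ.iInter fun n => (ho n).isGδ, dense_iInter_of_isOpen ho hd⟩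

theorem aux_step {X : Type*} [MetricSpace X] [CompactSpace X]
    (F : Set (X × X)) (hF : Suitable F) (D : Set X) (hG : IsGδ D) (hd : Dense D) :
    IsGδ (ONE F ∩ {x | ∀ y, (x, y) ∈ F → y ∈ D}) ∧
      Dense (ONE F ∩ {x | ∀ y, (x, y) ∈ F → y ∈ D}) := by
  obtain ⟨G, hGo, rfl⟩ := isGδ_iff_eq_iInter_nat.1 hG
  have h : {x | ∀ y, (x, y) ∈ F → y ∈ ⋂ n, G n} = ⋂ n, {x | ∀ y, (x, y) ∈ F → y ∈ G n} := by
    ext x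
    simp only [mem_ofPred_eq, mem_iInter]
    exact ⟨fun h n y hy => h y hy n, fun h y hy n => h n y hy⟩
  rw [h]
  have ho := fun n => aux_pull_open F hF (G n) (hGo n)
  have hdd := fun n => aux_pull_dense F hF (G n) (hGo n) (hd.mono (iInter_subset _ n))
  have h1 := IsGδ.iInter fun n => (ho n).isGδ
  obtain ⟨h2, h3⟩ := aux_one F hF
  exact ⟨h2.inter h1, Dense.inter_of_Gδ h2 h1 h3 (dense_iInter_of_isOpen ho hdd)⟩

theorem stmt19 {X : Type*} [MetricSpace X] [CompactSpace X]
    (F : Set (X × X)) (hF : Suitable F)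
    -- `Dplus` is `D⁺_F`: the set of points whose forward orbit under `f_F` is defined,
    -- i.e. stays in `ONE F`, for all times
    (Dplus : Set X)
    (hD : Dplus = {x | ∃ z : ℕ → X, z 0 = x ∧ ∀ n, z n ∈ ONE F ∧ (z n, z (n + 1)) ∈ F})
    -- `o` is the orbit map `o⁺_F` : on `Dplus`, `o x` is the orbit sequence of `x`,
    -- `(o x) n = (t_F)ⁿ x`
    (o : X → ℕ → X)
    (ho : ∀ x ∈ Dplus, (o x) 0 = x ∧ ∀ n, (o x) n ∈ ONE F ∧ ((o x) n, (o x) (n + 1)) ∈ F)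
    -- the sample path space `X⁺_F`
    (Xplus : Set (ℕ → X)) (hXp : Xplus = {z : ℕ → X | ∀ n, (z n, z (n + 1)) ∈ F})
    -- `S = S⁺_F` is the closure of the image of the orbit map
    (S : Set (ℕ → X)) (hS : S = closure (o '' Dplus)) :
    -- (a) D⁺_F is a dense Gδ subset of X
    (Dense Dplus ∧ IsGδ Dplus) ∧
    -- (b) o⁺_F is a homeomorphism from D⁺_F onto X⁺_F ∩ π₀⁻¹(D⁺_F); in particular for
    -- x ∈ D⁺_F, o x is the unique point of X⁺_F whose 0-th coordinate is x
    ((∀ x ∈ Dplus, o x ∈ Xplus ∧ ∀ z ∈ Xplus, z 0 = x → z = o x) ∧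
      ∃ e : Dplus ≃ₜ (Xplus ∩ {z : ℕ → X | z 0 ∈ Dplus} : Set (ℕ → X)),
        ∀ x : Dplus, (e x : ℕ → X) = o (x : X)) ∧
    -- (c) S⁺_F is the unique closed subset of X⁺_F minimal for the projection π₀, and
    -- the restriction ρ₀ of π₀ to S⁺_F is irreducible
    ((S ⊆ Xplus ∧ IsClosed S ∧ (∀ x : X, ∃ z ∈ S, z 0 = x) ∧
        ∀ B ⊆ S, IsClosed B → (∀ x : X, ∃ z ∈ B, z 0 = x) → B = S) ∧
      (∀ A ⊆ Xplus, IsClosed A → (∀ x : X, ∃ z ∈ A, z 0 = x) →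
        (∀ B ⊆ A, IsClosed B → (∀ x : X, ∃ z ∈ B, z 0 = x) → B = A) → A = S) ∧
      IrreducibleMap (fun z : S => (z : ℕ → X) 0)) ∧
    -- (d) S⁺_F is +invariant under the shift, and the restriction s_F of the shift to
    -- S⁺_F is an almost open continuous map
    (∃ hinv : Set.MapsTo (fun (z : ℕ → X) (n : ℕ) => z (n + 1)) S S,
      Continuous (Set.MapsTo.restrict _ S S hinv) ∧
      AlmostOpen (Set.MapsTo.restrict _ S S hinv)) := by
  obtain ⟨f, hf⟩ : ∃ f : X → X, ∀ x, (x, f x) ∈ F := by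
    choose f hf using aux_tot F hF
    exact ⟨f, hf⟩
  have hone : ∀ x ∈ ONE F, ∀ y y', (x, y) ∈ F → (x, y') ∈ F → y = y' := by
    rintro x ⟨a, ha⟩ y y' hy hy'
    have h1 : y ∈ {y' | (x, y') ∈ F} := hy
    have h2 : y' ∈ {y' | (x, y') ∈ F} := hy'
    rw [ha] at h1 h2
    exact h1.trans h2.symm
  -- (a)
  have ha : Dense Dplus ∧ IsGδ Dplus := by
    let P : Set X → Set X := fun D => ONE F ∩ {x | ∀ y, (x, y) ∈ F → y ∈ D}
    let E : ℕ → Set X := fun n => Nat.rec univ (fun _ D => P D) n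
    have hE : ∀ n, IsGδ (E n) ∧ Dense (E n) := by
      intro n
      induction n with
      | zero => exact ⟨IsGδ.univ, dense_univ⟩
      | succ k ih => exact aux_step F hF _ ih.1 ih.2
    have hDE : Dplus = ⋂ n, E n := by
      rw [hD]
      ext x
      simp only [mem_iInter, mem_ofPred_eq]
      constructor
      · rintro ⟨z, rfl, hz⟩ n
        have : ∀ n k, z k ∈ E n := by
          intro n
          induction n with
          | zero => intro k; exact mem_univ _
          | succ m ih =>
            intro k
            refine ⟨(hz k).1, fun y hy => ?_⟩
            rw [hone _ (hz k).1 _ _ hy (hz k).2]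
            exact ih _
        exact this n 0
      · intro h
        have key : ∀ n m, f^[n] x ∈ E m := by
          intro n
          induction n with
          | zero => exact h
          | succ k ih =>
            intro m
            rw [Function.iterate_succ_apply']
            exact (ih (m + 1)).2 _ (hf _)
        refine ⟨fun n => f^[n] x, rfl, fun n => ⟨(key n 1).1, ?_⟩⟩
        simp only [Function.iterate_succ_apply']
        exact hf _
    rw [hDE]
    exact ⟨dense_iInter_of_Gδ (fun n => (hE n).1) (fun n => (hE n).2),
      IsGδ.iInter fun n => (hE n).1⟩
  have hb1 : ∀ x ∈ Dplus, o x ∈ Xplus ∧ ∀ z ∈ Xplus, z 0 = x → z = o x := by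
    subst hXp
    intro x hx
    obtain ⟨h0, hn⟩ := ho x hx
    refine ⟨fun n => (hn n).2, fun z hz hz0 => ?_⟩
    funext n
    induction n with
    | zero => rw [hz0, h0]
    | succ k ih =>
      have h1 := hz k
      rw [ih] at h1
      exact hone _ (hn k).1 _ _ h1 (hn k).2
  have hXc : IsClosed Xplus := by
    rw [hXp]
    simp only [ofPred_forall]
    refine isClosed_iInter fun n => hF.1.preimage (by fun_prop)
  have hsub : o '' Dplus ⊆ Xplus := by
    rintro _ ⟨x, hx, rfl⟩
    exact (hb1 x hx).1
  have hocont : Continuous (fun x : Dplus => o x) := by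
    rw [continuous_iff_isClosed]
    intro C hC
    have : (fun x : Dplus => o x) ⁻¹' C =
        Subtype.val ⁻¹' ((fun z : ℕ → X => z 0) '' (C ∩ Xplus)) := by
      ext x
      constructor
      · intro h
        exact ⟨o x, ⟨h, (hb1 _ x.2).1⟩, (ho _ x.2).1⟩
      · rintro ⟨z, ⟨h1, h2⟩, h3⟩
        have h4 := (hb1 _ x.2).2 z h2 h3
        rw [mem_preimage, ← h4]
        exact h1
    rw [this]
    exact (((hC.inter hXc).isCompact.image (continuous_apply 0)).isClosed).preimage
      continuous_subtype_val
  have hSX : S ⊆ Xplus := hS ▸ closure_minimal hsub hXc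
  have hSc : IsClosed S := hS ▸ isClosed_closure
  have hoS : ∀ x ∈ Dplus, o x ∈ S := fun x hx => hS ▸ subset_closure ⟨x, hx, rfl⟩
  have hSonto : ∀ x : X, ∃ z ∈ S, z 0 = x := by
    intro x
    have hc : IsClosed ((fun z : ℕ → X => z 0) '' S) :=
      (hSc.isCompact.image (continuous_apply 0)).isClosed
    have : Dplus ⊆ (fun z : ℕ → X => z 0) '' S := fun x hx => ⟨o x, hoS x hx, (ho x hx).1⟩
    have h2 := closure_minimal this hc
    rw [ha.1.closure_eq] at h2
    exact h2 (mem_univ x)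
  have hmin : ∀ B ⊆ Xplus, IsClosed B → (∀ x : X, ∃ z ∈ B, z 0 = x) → S ⊆ B := by
    intro B hB hBc hBo
    rw [hS]
    refine closure_minimal ?_ hBc
    rintro _ ⟨x, hx, rfl⟩
    obtain ⟨z, hz, hz0⟩ := hBo x
    rw [← (hb1 x hx).2 z (hB hz) hz0]
    exact hz
  have hDf : ∀ x ∈ Dplus, f x ∈ Dplus ∧ o (f x) = fun n => o x (n + 1) := by
    intro x hx
    obtain ⟨h0, hn⟩ := ho x hx
    have h1 : o x 1 = f x := by
      have := (hn 0)
      rw [h0] at this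
      exact hone x this.1 _ _ this.2 (hf x)
    have h2 : f x ∈ Dplus := by
      rw [hD]
      exact ⟨fun n => o x (n + 1), h1, fun n => hn (n + 1)⟩
    refine ⟨h2, ((hb1 _ h2).2 _ ?_ h1).symm⟩
    rw [hXp]
    exact fun n => (hn (n + 1)).2
  have hsc : Continuous (fun (z : ℕ → X) (n : ℕ) => z (n + 1)) := by fun_prop
  have hL : ∀ O : Set (ℕ → X), IsOpen O → (S ∩ O).Nonempty →
      ∃ V : Set X, IsOpen V ∧ V.Nonempty ∧ ∀ z ∈ S, z 0 ∈ V → z ∈ O := by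
    rintro O hO ⟨w, hwS, hwO⟩
    have hcl : IsClosed (S \ O) := hSc.sdiff hO
    refine ⟨((fun z : ℕ → X => z 0) '' (S \ O))ᶜ,
      (hcl.isCompact.image (continuous_apply 0)).isClosed.isOpen_compl, ?_, ?_⟩
    · by_contra hne
      rw [not_nonempty_iff_eq_empty, compl_empty_iff] at hne
      have := hmin (S \ O) (sdiff_subset.trans hSX) hcl (fun x => by
        have : x ∈ (fun z : ℕ → X => z 0) '' (S \ O) := hne ▸ mem_univ x
        exact this)
      exact (this hwS).2 hwO
    · intro z hz hz0
      by_contra hc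
      exact hz0 ⟨z, ⟨hz, hc⟩, rfl⟩
  have hinv : Set.MapsTo (fun (z : ℕ → X) (n : ℕ) => z (n + 1)) S S := by
    rw [hS]
    refine MapsTo.closure ?_ hsc
    rintro _ ⟨x, hx, rfl⟩
    exact ⟨f x, (hDf x hx).1, (hDf x hx).2⟩
  refine ⟨ha, ⟨hb1, ?_⟩, ⟨⟨hSX, hSc, hSonto, ?_⟩, ?_, ?_⟩, hinv, ?_, ?_⟩
  · refine ⟨{ toFun := fun x => ⟨o x, (hb1 x x.2).1, ?_⟩
              invFun := fun z => ⟨(z : ℕ → X) 0, z.2.2⟩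
              left_inv := ?_
              right_inv := ?_
              continuous_toFun := ?_
              continuous_invFun := ?_ }, fun x => rfl⟩
    · change o x 0 ∈ Dplus
      rw [(ho x x.2).1]; exact x.2
    · intro x
      exact Subtype.ext (ho x x.2).1
    · intro z
      exact Subtype.ext ((hb1 _ z.2.2).2 z z.2.1 rfl).symm
    · exact hocont.subtype_mk _
    · exact ((continuous_apply 0).comp continuous_subtype_val).subtype_mk _
  · intro B hB hBc hBo
    exact hB.antisymm (hmin B (hB.trans hSX) hBc hBo)
  · intro A hA hAc hAo hAm
    exact (hAm S (hmin A hA hAc hAo) hSc hSonto).symm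
  · refine ⟨fun x => ?_, fun A hA hAu => ?_⟩
    · obtain ⟨z, hz, h⟩ := hSonto x
      exact ⟨⟨z, hz⟩, h⟩
    · have h1 := hmin (Subtype.val '' A) (by rintro _ ⟨z, -, rfl⟩; exact hSX z.2)
        (hSc.isClosedEmbedding_subtypeVal.isClosedMap A hA) (fun x => by
          obtain ⟨z, hz, h⟩ : x ∈ (fun z : S => (z : ℕ → X) 0) '' A := hAu ▸ mem_univ x
          exact ⟨z, ⟨z, hz, rfl⟩, h⟩)
      ext z
      simp only [mem_univ, iff_true]
      obtain ⟨w, hw, h⟩ := h1 z.2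
      rwa [← Subtype.ext h]
  · exact hsc.restrict hinv
  · intro U hU ⟨u, hu⟩
    obtain ⟨O, hO, rfl⟩ := isOpen_induced_iff.1 hU
    obtain ⟨V, hV, ⟨v, hv⟩, hVO⟩ := hL O hO ⟨u, u.2, hu⟩
    obtain ⟨r, hr, hrV⟩ := Metric.nhds_basis_closedBall.mem_iff.1 (hV.mem_nhds hv)
    obtain ⟨g, hg⟩ := aux_meet F hF (Metric.ball v r) Metric.isOpen_ball
      ⟨v, Metric.mem_ball_self hr⟩
    set G := interior (Prod.snd '' (F ∩ Prod.fst ⁻¹' Metric.ball v r)) with hGdef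
    have hGo : IsOpen G := isOpen_interior
    obtain ⟨w₀, hw₀, hw₀g⟩ := hSonto g
    refine ⟨⟨w₀, hw₀⟩, ?_⟩
    have hop : IsOpen {w : S | (w : ℕ → X) 0 ∈ G} :=
      hGo.preimage ((continuous_apply 0).comp continuous_subtype_val)
    refine interior_maximal ?_ hop (show w₀ 0 ∈ G from hw₀g ▸ hg)
    have hK : IsClosed (S ∩ {z : ℕ → X | z 0 ∈ Metric.closedBall v r}) :=
      hSc.inter (Metric.isClosed_closedBall.preimage (continuous_apply 0))
    have hC := (hK.isCompact.image hsc).isClosed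
    intro w hw
    have hwC : (w : ℕ → X) ∈ (fun (z : ℕ → X) (n : ℕ) => z (n + 1)) ''
        (S ∩ {z : ℕ → X | z 0 ∈ Metric.closedBall v r}) := by
      by_contra hwC
      obtain ⟨V', hV', ⟨v', hv'⟩, hVO'⟩ := hL _
        (hC.isOpen_compl.inter (hGo.preimage (continuous_apply 0))) ⟨w, w.2, hwC, hw⟩
      obtain ⟨z, hzS, hz⟩ := hSonto v'
      have hzG : z 0 ∈ G := (hVO' z hzS (hz ▸ hv')).2
      rw [hz] at hzG
      obtain ⟨p, ⟨hp, hpV⟩, hpe⟩ := interior_subset hzG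
      have hWo : IsOpen (Metric.ball v r ×ˢ V') := Metric.isOpen_ball.prod hV'
      have h1 := aux_nonempty F hF _ hWo ⟨p, hp, hpV, hpe ▸ hv'⟩
      obtain ⟨x, hx, hxD⟩ := dense_iff_inter_open.1 ha.1 _ (aux_open F hF _ hWo) h1
      have hxf := hx _ (hf x)
      obtain ⟨hfD, hof⟩ := hDf x hxD
      have h3 := (hVO' (o (f x)) (hoS _ hfD) (by rw [(ho _ hfD).1]; exact hxf.2)).1
      refine h3 ⟨o x, ⟨hoS x hxD, ?_⟩, hof.symm⟩
      rw [mem_ofPred_eq, (ho _ hxD).1]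
      exact Metric.ball_subset_closedBall hxf.1
    obtain ⟨z, ⟨hzS, hzK⟩, hzw⟩ := hwC
    exact ⟨⟨z, hzS⟩, hVO z hzS (hrV hzK), Subtype.ext hzw⟩
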